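/- There exists a constant B, depending only on n, m, α, β, ρ, with the following property. Let L ∈ ℤ, let a be measurable, supported in ½Q, with |a| ≤ 2^{(n+m)(1−L)} pointwise and ∬ a(x,y) dx dy = 0, and let k, ℓ ≥ 1 be integers such that k + L < 0 and ℓ < k. Then for every (x,y) ∈ Q_{kℓ}: |I a(x,y)| ≤ B · 2^{L} · 2^{(k+L)(α−n)} · (2^{ρ(k+L)} + 2^{ℓ+L})^{β−m} · (2^{ρ(k+L)} + 2^{ℓ+L})^{−1}. -/

import Mathlib

open MeasureTheory

/-- The flag kernel `Ω(x,y) = |x|^(α-n) (|x|^ρ + |y|)^(β-m)` on `ℝ^n × ℝ^m`. -/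
noncomputable def flagKernel (n m : ℕ) (α β ρ : ℝ)
    (x : EuclideanSpace ℝ (Fin n)) (y : EuclideanSpace ℝ (Fin m)) : ℝ :=
  ‖x‖ ^ (α - (n : ℝ)) * (‖x‖ ^ ρ + ‖y‖) ^ (β - (m : ℝ))

/-- The fractional integral operator `I f(x,y) = ∬ f(u,v) Ω(x-u, y-v) du dv`. -/
noncomputable def flagOp (n m : ℕ) (α β ρ : ℝ)
    (f : EuclideanSpace ℝ (Fin n) × EuclideanSpace ℝ (Fin m) → ℝ)
    (z : EuclideanSpace ℝ (Fin n) × EuclideanSpace ℝ (Fin m)) : ℝ :=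
  ∫ w : EuclideanSpace ℝ (Fin n) × EuclideanSpace ℝ (Fin m),
    f w * flagKernel n m α β ρ (z.1 - w.1) (z.2 - w.2)

/-- The `ℓ^∞` (sup) norm `‖x‖_∞` of a point of Euclidean space. -/
noncomputable def supAbs {n : ℕ} (x : EuclideanSpace ℝ (Fin n)) : ℝ :=
  ‖(WithLp.equiv 2 (Fin n → ℝ)) x‖

lemma supAbs_le_norm {n : ℕ} (x : EuclideanSpace ℝ (Fin n)) : supAbs x ≤ ‖x‖ :=
  (pi_norm_le_iff_of_nonneg (norm_nonneg x)).2 fun i => PiLp.norm_apply_le x i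

lemma supAbs_nonneg {n : ℕ} (x : EuclideanSpace ℝ (Fin n)) : 0 ≤ supAbs x :=
  norm_nonneg _

lemma norm_le_mul_supAbs {n : ℕ} (x : EuclideanSpace ℝ (Fin n)) : ‖x‖ ≤ n * supAbs x := by
  have h : ∀ i, ‖x i‖ ^ 2 ≤ supAbs x ^ 2 := fun i =>
    pow_le_pow_left₀ (norm_nonneg _) (norm_le_pi_norm (WithLp.equiv 2 (Fin n → ℝ) x) i) 2
  have hn : (n : ℝ) ≤ (n : ℝ) ^ 2 := by
    exact_mod_cast Nat.le_self_pow two_ne_zero n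
  rw [EuclideanSpace.norm_eq]
  refine Real.sqrt_le_iff.2 ⟨mul_nonneg n.cast_nonneg (supAbs_nonneg x), ?_⟩
  calc ∑ i, ‖x i‖ ^ 2 ≤ ∑ _i : Fin n, supAbs x ^ 2 := Finset.sum_le_sum fun i _ => h i
    _ = n * supAbs x ^ 2 := by simp
    _ ≤ (n * supAbs x) ^ 2 := by
      rw [mul_pow]
      exact mul_le_mul_of_nonneg_right hn (sq_nonneg _)

lemma supAbs_sub_supAbs_le {n : ℕ} (x u : EuclideanSpace ℝ (Fin n)) :
    supAbs x - supAbs u ≤ supAbs (x - u) :=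
  norm_sub_norm_le (WithLp.equiv 2 (Fin n → ℝ) x) (WithLp.equiv 2 (Fin n → ℝ) u)

lemma supAbs_sub_le {n : ℕ} (x u : EuclideanSpace ℝ (Fin n)) :
    supAbs (x - u) ≤ supAbs x + supAbs u :=
  norm_sub_le (WithLp.equiv 2 (Fin n → ℝ) x) (WithLp.equiv 2 (Fin n → ℝ) u)

/-- Lipschitz bound for a nonpositive power on `[b, ∞)`. -/
lemma abs_rpow_sub_rpow_le_of_nonpos {p b s t : ℝ} (hp : p ≤ 0) (hb : 0 < b)
    (hs : b ≤ s) (ht : b ≤ t) : |s ^ p - t ^ p| ≤ |p| * b ^ (p - 1) * |s - t| := by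
  refine (convex_Ici b).norm_image_sub_le_of_norm_hasDerivWithin_le
    (f := fun x : ℝ => x ^ p) (f' := fun x => p * x ^ (p - 1)) (fun x hx => ?_) (fun x hx => ?_)
    ht hs
  · exact (Real.hasDerivAt_rpow_const (Or.inl (hb.trans_le hx).ne')).hasDerivWithinAt
  · rw [norm_mul, Real.norm_eq_abs, Real.norm_of_nonneg (Real.rpow_nonneg (hb.le.trans hx) _)]
    exact mul_le_mul_of_nonneg_left
      (Real.rpow_le_rpow_of_nonpos hb hx (by linarith)) (abs_nonneg p)

/-- Lipschitz bound for a power at least one on `[0, C]`. -/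
lemma abs_rpow_sub_rpow_le_of_one_le {r C s t : ℝ} (hr : 1 ≤ r)
    (hs : s ∈ Set.Icc 0 C) (ht : t ∈ Set.Icc 0 C) :
    |s ^ r - t ^ r| ≤ r * C ^ (r - 1) * |s - t| := by
  refine (convex_Icc 0 C).norm_image_sub_le_of_norm_hasDerivWithin_le
    (f := fun x : ℝ => x ^ r) (f' := fun x => r * x ^ (r - 1)) (fun x hx => ?_) (fun x hx => ?_)
    ht hs
  · exact (Real.hasDerivAt_rpow_const (Or.inr hr)).hasDerivWithinAt
  · rw [norm_mul, Real.norm_of_nonneg (by linarith), Real.norm_of_nonneg (Real.rpow_nonneg hx.1 _)]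
    exact mul_le_mul_of_nonneg_left
      (Real.rpow_le_rpow hx.1 hx.2 (by linarith)) (by linarith)

/-- Regularity of the flag kernel as a function of the two radii. -/
lemma abs_flagProfile_sub_le {p q r c C X Y A A' D D' δ : ℝ} (hp : p ≤ 0) (hq : q ≤ 0)
    (hr : 1 ≤ r) (hc : 0 < c) (hc1 : c ≤ 1) (hX : 0 < X) (hX1 : X ≤ 1) (hY : 0 < Y)
    (hYX : Y ≤ X) (hA : c * X ≤ A) (hA' : c * X ≤ A') (hAC : A ≤ C) (hAC' : A' ≤ C)
    (hD : c * Y ≤ D) (hD' : c * Y ≤ D') (hδA : |A - A'| ≤ δ) (hδD : |D - D'| ≤ δ) :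
    |A ^ p * (A ^ r + D) ^ q - A' ^ p * (A' ^ r + D') ^ q| ≤
      (2 * |p| * c ^ (p - 1) * (c ^ r) ^ q +
        c ^ p * (|q| * (c ^ r) ^ (q - 1) * (r * C ^ (r - 1) + 1))) *
        (δ * (X ^ p * (X ^ r + Y) ^ q * (X ^ r + Y)⁻¹)) := by
  have hδ : 0 ≤ δ := (abs_nonneg _).trans hδA
  have hcX : 0 < c * X := mul_pos hc hX
  have hA0 : 0 < A := hcX.trans_le hA
  have hA0' : 0 < A' := hcX.trans_le hA'
  have hC : 0 < C := hA0.trans_le hAC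
  have hS : 0 < X ^ r + Y := by positivity
  have hcr : 0 < c ^ r := by positivity
  have hlow : ∀ {a d : ℝ}, c * X ≤ a → c * Y ≤ d → c ^ r * (X ^ r + Y) ≤ a ^ r + d := by
    intro a d ha hd
    have h1 : (c * X) ^ r ≤ a ^ r := Real.rpow_le_rpow hcX.le ha (by linarith)
    rw [Real.mul_rpow hc.le hX.le] at h1
    have h2 : c ^ r ≤ c := by
      simpa using Real.rpow_le_rpow_of_exponent_ge hc hc1 hr
    have h3 := mul_le_mul_of_nonneg_right h2 hY.le
    rw [mul_add]
    linarith
  have hE := hlow hA hD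
  have hE' := hlow hA' hD'
  have hb : 0 < c ^ r * (X ^ r + Y) := mul_pos hcr hS
  have hXS : X⁻¹ ≤ 2 * (X ^ r + Y)⁻¹ := by
    have : X ^ r ≤ X := by simpa using Real.rpow_le_rpow_of_exponent_ge hX hX1 hr
    rw [inv_eq_one_div, ← div_eq_mul_inv, div_le_div_iff₀ hX hS]
    linarith
  have hP : |A ^ p - A' ^ p| ≤ 2 * |p| * c ^ (p - 1) * X ^ p * (X ^ r + Y)⁻¹ * δ := by
    calc |A ^ p - A' ^ p| ≤ |p| * (c * X) ^ (p - 1) * |A - A'| :=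
          abs_rpow_sub_rpow_le_of_nonpos hp hcX hA hA'
      _ ≤ |p| * (c * X) ^ (p - 1) * δ := by gcongr
      _ = |p| * c ^ (p - 1) * X ^ p * X⁻¹ * δ := by
          rw [Real.mul_rpow hc.le hX.le, Real.rpow_sub_one hX.ne']
          ring
      _ ≤ |p| * c ^ (p - 1) * X ^ p * (2 * (X ^ r + Y)⁻¹) * δ := by gcongr
      _ = _ := by ring
  have hEE : |(A ^ r + D) - (A' ^ r + D')| ≤ (r * C ^ (r - 1) + 1) * δ := by
    calc |(A ^ r + D) - (A' ^ r + D')| = |(A ^ r - A' ^ r) + (D - D')| := by ring_nf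
      _ ≤ |A ^ r - A' ^ r| + |D - D'| := abs_add_le _ _
      _ ≤ r * C ^ (r - 1) * |A - A'| + |D - D'| := by
          gcongr
          exact abs_rpow_sub_rpow_le_of_one_le hr ⟨hA0.le, hAC⟩ ⟨hA0'.le, hAC'⟩
      _ ≤ r * C ^ (r - 1) * δ + δ := by gcongr
      _ = _ := by ring
  have hQ : |(A ^ r + D) ^ q - (A' ^ r + D') ^ q| ≤
      |q| * (c ^ r) ^ (q - 1) * (r * C ^ (r - 1) + 1) * (X ^ r + Y) ^ q * (X ^ r + Y)⁻¹ * δ := by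
    calc |(A ^ r + D) ^ q - (A' ^ r + D') ^ q|
        ≤ |q| * (c ^ r * (X ^ r + Y)) ^ (q - 1) * |(A ^ r + D) - (A' ^ r + D')| :=
          abs_rpow_sub_rpow_le_of_nonpos hq hb hE hE'
      _ ≤ |q| * (c ^ r * (X ^ r + Y)) ^ (q - 1) * ((r * C ^ (r - 1) + 1) * δ) := by gcongr
      _ = _ := by
          rw [Real.mul_rpow hcr.le hS.le, Real.rpow_sub_one hS.ne']
          ring
  have hEq : (A ^ r + D) ^ q ≤ (c ^ r) ^ q * (X ^ r + Y) ^ q := by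
    rw [← Real.mul_rpow hcr.le hS.le]
    exact Real.rpow_le_rpow_of_nonpos hb hE hq
  have hAp : A' ^ p ≤ c ^ p * X ^ p := by
    rw [← Real.mul_rpow hc.le hX.le]
    exact Real.rpow_le_rpow_of_nonpos hcX hA' hp
  have hE0 : 0 ≤ A ^ r + D := hb.le.trans hE
  calc |A ^ p * (A ^ r + D) ^ q - A' ^ p * (A' ^ r + D') ^ q|
      = |(A ^ p - A' ^ p) * (A ^ r + D) ^ q
          + A' ^ p * ((A ^ r + D) ^ q - (A' ^ r + D') ^ q)| := by ring_nf
    _ ≤ |A ^ p - A' ^ p| * (A ^ r + D) ^ q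
          + A' ^ p * |(A ^ r + D) ^ q - (A' ^ r + D') ^ q| := by
        refine (abs_add_le _ _).trans_eq ?_
        rw [abs_mul, abs_mul, abs_of_nonneg (Real.rpow_nonneg hE0 q),
          abs_of_nonneg (Real.rpow_nonneg hA0'.le p)]
    _ ≤ (2 * |p| * c ^ (p - 1) * X ^ p * (X ^ r + Y)⁻¹ * δ) * ((c ^ r) ^ q * (X ^ r + Y) ^ q)
          + (c ^ p * X ^ p) * (|q| * (c ^ r) ^ (q - 1) * (r * C ^ (r - 1) + 1)
            * (X ^ r + Y) ^ q * (X ^ r + Y)⁻¹ * δ) := by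
        gcongr
    _ = _ := by ring

/-- An integral against a mean-zero bounded function supported in `s` is controlled by the
oscillation of the kernel over the support. -/
lemma abs_integral_mul_le_of_integral_eq_zero {E : Type*} [MeasurableSpace E] {μ : Measure E}
    {a g : E → ℝ} {s : Set E} {M T g₀ : ℝ} (hμs : μ s < ⊤)
    (ha : Measurable a) (hsupp : ∀ w, a w ≠ 0 → w ∈ s) (hM : ∀ w, |a w| ≤ M)
    (hint : ∫ w, a w ∂μ = 0) (hT : 0 ≤ T) (hg : ∀ w, a w ≠ 0 → |g w - g₀| ≤ T) (hM0 : 0 ≤ M) :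
    |∫ w, a w * g w ∂μ| ≤ M * T * μ.real s := by
  by_cases hag : Integrable (fun w => a w * g w) μ
  · have hai : Integrable a μ := by
      refine (integrableOn_iff_integrable_of_support_subset hsupp).1 ?_
      exact Measure.integrableOn_of_bounded hμs.ne ha.aestronglyMeasurable
        (Filter.Eventually.of_forall hM)
    have h1 : ∫ w, a w * g w ∂μ = ∫ w, a w * (g w - g₀) ∂μ := by
      simp_rw [mul_sub]
      rw [integral_sub hag (hai.mul_const g₀), integral_mul_const, hint, zero_mul, sub_zero]
    rw [h1, ← setIntegral_eq_integral_of_forall_compl_eq_zero (s := s), ← Real.norm_eq_abs]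
    · refine norm_setIntegral_le_of_norm_le_const hμs fun w _ => ?_
      rw [Real.norm_eq_abs, abs_mul]
      by_cases hw : a w = 0
      · simpa [hw] using mul_nonneg hM0 hT
      · exact mul_le_mul (hM w) (hg w hw) (abs_nonneg _) hM0
    · intro w hw
      have : a w = 0 := by_contra fun h => hw (hsupp w h)
      simp [this]
  · rw [integral_undef hag, abs_zero]
    positivity

lemma measureReal_closedBall_prod_closedBall (n m : ℕ) {R : ℝ} (hR : 0 ≤ R) :
    (volume : Measure (EuclideanSpace ℝ (Fin n) × EuclideanSpace ℝ (Fin m))).real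
        (Metric.closedBall 0 R ×ˢ Metric.closedBall 0 R) =
      R ^ (n + m) * ((volume : Measure (EuclideanSpace ℝ (Fin n))).real (Metric.ball 0 1) *
        (volume : Measure (EuclideanSpace ℝ (Fin m))).real (Metric.ball 0 1)) := by
  rw [Measure.volume_eq_prod, measureReal_prod_prod,
    Measure.addHaar_real_closedBall (volume : Measure (EuclideanSpace ℝ (Fin n))) 0 hR,
    Measure.addHaar_real_closedBall (volume : Measure (EuclideanSpace ℝ (Fin m))) 0 hR]
  simp only [finrank_euclideanSpace_fin]
  ring

/-- On a dyadic shell, subtracting a point of the half cube preserves the order of magnitude. -/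
lemma norm_sub_bounds_of_shell {n : ℕ} {x u : EuclideanSpace ℝ (Fin n)} {X : ℝ}
    (hx : X / 2 ≤ supAbs x) (hx' : supAbs x ≤ X) (hu : supAbs u ≤ X / 8) :
    1 / 4 * X ≤ ‖x - u‖ ∧ ‖x - u‖ ≤ n * (2 * X) := by
  have h1 := supAbs_sub_supAbs_le x u
  have h2 := supAbs_sub_le x u
  have h3 := supAbs_le_norm (x - u)
  have h4 := supAbs_nonneg u
  refine ⟨by linarith, (norm_le_mul_supAbs _).trans ?_⟩
  gcongr
  linarith

/-- Pointwise estimate in Case 2 when `k + L < 0` and `ℓ < k`: on the shell `Q_{kℓ}`,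
`|I a| ≤ B 2^L 2^{(k+L)(α-n)} (2^{ρ(k+L)} + 2^{ℓ+L})^{β-m} (2^{ρ(k+L)} + 2^{ℓ+L})⁻¹`. -/
theorem flagOp_atom_pointwise_case2b (n m : ℕ) (hn : 0 < n) (hm : 0 < m) (α β ρ : ℝ)
    (hα : 0 < α) (hαn : α < n) (hβ : 0 < β) (hβm : β < m) (hρ : 1 ≤ ρ) :
    ∃ B : ℝ, 0 < B ∧
      ∀ (L : ℤ) (a : EuclideanSpace ℝ (Fin n) × EuclideanSpace ℝ (Fin m) → ℝ),
        Measurable a →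
        (∀ w, a w ≠ 0 → max (supAbs w.1) (supAbs w.2) ≤ (2 : ℝ) ^ (L - 2)) →
        (∀ w, |a w| ≤ (2 : ℝ) ^ (((n : ℤ) + m) * (1 - L))) →
        (∫ w : EuclideanSpace ℝ (Fin n) × EuclideanSpace ℝ (Fin m), a w) = 0 →
        ∀ (k l : ℕ), 1 ≤ k → 1 ≤ l → (k : ℤ) + L < 0 → l < k →
        ∀ w : EuclideanSpace ℝ (Fin n) × EuclideanSpace ℝ (Fin m),
          ((2 : ℝ) ^ (L + (k : ℤ) - 1) ≤ supAbs w.1 ∧ supAbs w.1 < (2 : ℝ) ^ (L + (k : ℤ))) →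
          ((2 : ℝ) ^ (L + (l : ℤ) - 1) ≤ supAbs w.2 ∧ supAbs w.2 < (2 : ℝ) ^ (L + (l : ℤ))) →
          |flagOp n m α β ρ a w| ≤
            B * (2 : ℝ) ^ (L : ℝ) * (2 : ℝ) ^ (((k : ℝ) + (L : ℝ)) * (α - n)) *
              ((2 : ℝ) ^ (ρ * ((k : ℝ) + (L : ℝ))) + (2 : ℝ) ^ ((l : ℝ) + (L : ℝ))) ^
                (β - (m : ℝ)) *
              ((2 : ℝ) ^ (ρ * ((k : ℝ) + (L : ℝ))) + (2 : ℝ) ^ ((l : ℝ) + (L : ℝ)))⁻¹ := by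
  set N : ℝ := (n : ℝ) + m
  have hn1 : (1 : ℝ) ≤ n := by exact_mod_cast hn
  have hm1 : (1 : ℝ) ≤ m := by exact_mod_cast hm
  have hN0 : 0 < N := by positivity
  set K : ℝ := 2 * |α - n| * (1 / 4) ^ (α - n - 1) * ((1 / 4) ^ ρ) ^ (β - m) +
    (1 / 4) ^ (α - n) * (|β - m| * ((1 / 4) ^ ρ) ^ (β - m - 1) * (ρ * (N * 2) ^ (ρ - 1) + 1))
  set V : ℝ := (volume : Measure (EuclideanSpace ℝ (Fin n))).real (Metric.ball 0 1) *
    (volume : Measure (EuclideanSpace ℝ (Fin m))).real (Metric.ball 0 1)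
  have hK0 : 0 ≤ K := by positivity
  have hV0 : 0 ≤ V := by positivity
  refine ⟨N ^ (n + m) * V * K * N + 1, by positivity, ?_⟩
  intro L a ha hsupp hbound hint k l hk hl hkL hlk z hz1 hz2
  set X : ℝ := (2 : ℝ) ^ ((k : ℝ) + (L : ℝ))
  set Y : ℝ := (2 : ℝ) ^ ((l : ℝ) + (L : ℝ))
  have hX0 : 0 < X := by positivity
  have hY0 : 0 < Y := by positivity
  have hX1 : X ≤ 1 := Real.rpow_le_one_of_one_le_of_nonpos one_le_two (by exact_mod_cast hkL.le)
  have hYX : Y ≤ X := Real.rpow_le_rpow_of_exponent_le one_le_two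
    (by have : (l : ℝ) < k := by exact_mod_cast hlk
        linarith)
  have hshell : ∀ j : ℕ, (2 : ℝ) ^ (L + (j : ℤ)) = (2 : ℝ) ^ ((j : ℝ) + (L : ℝ)) := by
    intro j
    rw [← Real.rpow_intCast]
    push_cast
    rw [add_comm]
  have hscale : ∀ j : ℕ, 1 ≤ j → (2 : ℝ) ^ (L - 2) ≤ (2 : ℝ) ^ ((j : ℝ) + (L : ℝ)) / 8 := by
    intro j hj
    rw [← hshell, show (8 : ℝ) = 2 ^ (3 : ℤ) by norm_num, ← zpow_sub₀ two_ne_zero]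
    exact zpow_le_zpow_right₀ one_le_two (by omega)
  rw [zpow_sub_one₀ two_ne_zero, hshell, ← div_eq_mul_inv] at hz1 hz2
  set R : ℝ := N * (2 : ℝ) ^ (L - 2) with hR
  have hR0 : 0 ≤ R := by positivity
  have hRL : R ≤ N * (2 : ℝ) ^ (L : ℝ) := by
    rw [hR, Real.rpow_intCast]
    gcongr
    · exact one_le_two
    · omega
  have hsmall : ∀ w, a w ≠ 0 → ‖w.1‖ ≤ R ∧ ‖w.2‖ ≤ R := by
    intro w hw
    obtain ⟨h1, h2⟩ := max_le_iff.1 (hsupp w hw)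
    refine ⟨(norm_le_mul_supAbs _).trans ?_, (norm_le_mul_supAbs _).trans ?_⟩
    · exact mul_le_mul (by linarith) h1 (supAbs_nonneg _) hN0.le
    · exact mul_le_mul (by linarith) h2 (supAbs_nonneg _) hN0.le
  set T : ℝ := K * (R * (X ^ (α - n) * (X ^ ρ + Y) ^ (β - m) * (X ^ ρ + Y)⁻¹))
  have hosc : ∀ w, a w ≠ 0 →
      |flagKernel n m α β ρ (z.1 - w.1) (z.2 - w.2) - flagKernel n m α β ρ z.1 z.2| ≤ T := by
    intro w hw
    obtain ⟨h1, h2⟩ := max_le_iff.1 (hsupp w hw)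
    obtain ⟨hw1, hw2⟩ := hsmall w hw
    have b1 := norm_sub_bounds_of_shell hz1.1 hz1.2.le (h1.trans (hscale k hk))
    have b2 := norm_sub_bounds_of_shell hz2.1 hz2.2.le (h2.trans (hscale l hl))
    have hzero : ∀ {d : ℕ}, supAbs (0 : EuclideanSpace ℝ (Fin d)) = 0 := fun {d} =>
      le_antisymm ((supAbs_le_norm _).trans_eq norm_zero) (supAbs_nonneg _)
    have b3 := norm_sub_bounds_of_shell (u := 0) hz1.1 hz1.2.le (by rw [hzero]; positivity)
    have b4 := norm_sub_bounds_of_shell (u := 0) hz2.1 hz2.2.le (by rw [hzero]; positivity)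
    rw [sub_zero] at b3 b4
    have hup : (n : ℝ) * (2 * X) ≤ N * 2 :=
      mul_le_mul (by linarith) (by linarith) (by positivity) hN0.le
    refine abs_flagProfile_sub_le (by linarith) (by linarith) hρ (by norm_num) (by norm_num)
      hX0 hX1 hY0 hYX b1.1 b3.1 (b1.2.trans hup) (b3.2.trans hup) b2.1 b4.1 ?_ ?_
    · exact (abs_norm_sub_norm_le _ _).trans (by simpa using hw1)
    · exact (abs_norm_sub_norm_le _ _).trans (by simpa using hw2)
  have hT0 : 0 ≤ T := by positivity
  have hmain := abs_integral_mul_le_of_integral_eq_zero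
    (s := Metric.closedBall (0 : EuclideanSpace ℝ (Fin n)) R ×ˢ
      Metric.closedBall (0 : EuclideanSpace ℝ (Fin m)) R)
    ((isCompact_closedBall _ _).prod (isCompact_closedBall _ _)).measure_lt_top ha
    (fun w hw => ⟨by simpa using (hsmall w hw).1,
      by simpa using (hsmall w hw).2⟩)
    hbound hint hT0 hosc (by positivity)
  rw [measureReal_closedBall_prod_closedBall n m hR0] at hmain
  have hmass : (2 : ℝ) ^ (((n : ℤ) + m) * (1 - L)) * R ^ (n + m) ≤ N ^ (n + m) := by
    have h1 : (2 : ℝ) ^ (((n : ℤ) + m) * (1 - L)) = ((2 : ℝ) ^ (1 - L)) ^ (n + m) := by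
      rw [mul_comm, zpow_mul, ← Nat.cast_add, zpow_natCast]
    have h2 : (2 : ℝ) ^ (1 - L) * R = N * 2⁻¹ := by
      rw [hR, mul_left_comm, ← zpow_add₀ two_ne_zero, show 1 - L + (L - 2) = -1 by ring,
        zpow_neg_one]
    rw [h1, ← mul_pow, h2]
    gcongr
    linarith
  rw [show (2 : ℝ) ^ (((k : ℝ) + (L : ℝ)) * (α - n)) = X ^ (α - n) from
      Real.rpow_mul zero_le_two _ _,
    show (2 : ℝ) ^ (ρ * ((k : ℝ) + (L : ℝ))) = X ^ ρ by
      rw [mul_comm]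
      exact Real.rpow_mul zero_le_two _ _]
  set Z : ℝ := X ^ (α - n) * (X ^ ρ + Y) ^ (β - m) * (X ^ ρ + Y)⁻¹ with hZ
  have hZ0 : 0 ≤ Z := by positivity
  calc |flagOp n m α β ρ a z|
      ≤ (2 : ℝ) ^ (((n : ℤ) + m) * (1 - L)) * T * (R ^ (n + m) * V) := hmain
    _ = ((2 : ℝ) ^ (((n : ℤ) + m) * (1 - L)) * R ^ (n + m)) * V * (K * (R * Z)) := by ring
    _ ≤ N ^ (n + m) * V * (K * ((N * (2 : ℝ) ^ (L : ℝ)) * Z)) := by gcongr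
    _ = (N ^ (n + m) * V * K * N) * ((2 : ℝ) ^ (L : ℝ) * Z) := by ring
    _ ≤ (N ^ (n + m) * V * K * N + 1) * ((2 : ℝ) ^ (L : ℝ) * Z) := by
        gcongr
        linarith
    _ = _ := by rw [hZ]; ring
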